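/- Suppose N(t,x,y) = ½ ∂Γ/∂y(t,x,y) (half the Jacobian matrix of Γ in the variables y), with Γ smooth and the Γ^l_{rs} arbitrary smooth symmetric functions. Then Φ ≡ 0 modulo ω: for every p ∈ P and all tangent vectors u, v at p satisfying ω_p(u) = ω_p(v) = 0 and Π_p(u) = Π_p(v) = 0, one has Φ_p(u,v) = 0. (This is the computational core of Chern's theorem: to each system of second order ODEs x″ + Γ(t,x,x′) = 0 there is a normal Galilean connection with Φ = 0 mod ω.) -/

import Mathlib

attribute [local instance] Matrix.normedAddCommGroup Matrix.normedSpace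

/-- The base space `ℝ × ℝⁿ × ℝⁿ` (first jet bundle coordinates `(t,x,y)`). -/
abbrev JetPt (n : ℕ) := ℝ × (Fin n → ℝ) × (Fin n → ℝ)

/-- The ambient vector space of the bundle `P = ℝ × ℝⁿ × ℝⁿ × GL_n(ℝ)`;
a point is `p = (t,x,y,A)` and a tangent vector is `ξ = (ξ_t, ξ_x, ξ_y, ξ_A)`. -/
abbrev GalTot (n : ℕ) := ℝ × (Fin n → ℝ) × (Fin n → ℝ) × Matrix (Fin n) (Fin n) ℝ

/-- Projection `(t,x,y,A) ↦ (t,x,y)`. -/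
def baseOf {n : ℕ} (p : GalTot n) : JetPt n := (p.1, p.2.1, p.2.2.1)

/-- The 1-form `τ_p(ξ) = ξ_t`. -/
def tauF {n : ℕ} (_p ξ : GalTot n) : ℝ := ξ.1

/-- The 1-form `ω_p(ξ) = A⁻¹(ξ_x − ξ_t y)`. -/
noncomputable def omegaF {n : ℕ} (p ξ : GalTot n) : Fin n → ℝ :=
  (p.2.2.2)⁻¹.mulVec (ξ.2.1 - ξ.1 • p.2.2.1)

/-- The 1-form `φ_p(ξ) = A⁻¹(ξ_y + ξ_t Γ(t,x,y) + N(t,x,y)(ξ_x − ξ_t y))`. -/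
noncomputable def phiF {n : ℕ} (Γ : JetPt n → Fin n → ℝ) (N : JetPt n → Matrix (Fin n) (Fin n) ℝ)
    (p ξ : GalTot n) : Fin n → ℝ :=
  (p.2.2.2)⁻¹.mulVec
    (ξ.2.2.1 + ξ.1 • Γ (baseOf p) + (N (baseOf p)).mulVec (ξ.2.1 - ξ.1 • p.2.2.1))

/-- The `M_n(ℝ)`-valued 1-form
`Π_p(ξ)^i_j = (A⁻¹ξ_A)^i_j + ξ_t (A⁻¹NA)^i_j + Σ_{l,r,s} (A⁻¹)^i_l Γ^l_{rs} A^r_j (ξ_x − ξ_t y)^s`. -/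
noncomputable def piF {n : ℕ} (N : JetPt n → Matrix (Fin n) (Fin n) ℝ)
    (Γ3 : JetPt n → Fin n → Fin n → Fin n → ℝ) (p ξ : GalTot n) :
    Matrix (Fin n) (Fin n) ℝ :=
  (p.2.2.2)⁻¹ * ξ.2.2.2 + ξ.1 • ((p.2.2.2)⁻¹ * N (baseOf p) * p.2.2.2) +
    Matrix.of fun i j => ∑ l, ∑ r, ∑ s,
      (p.2.2.2)⁻¹ i l * Γ3 (baseOf p) l r s * p.2.2.2 r j * (ξ.2.1 - ξ.1 • p.2.2.1) s

/-- Exterior derivative of a (vector- or matrix-valued) 1-form, evaluated on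
constant vectors: `dα_p(u,v) = D(q ↦ α_q(v))(p)(u) − D(q ↦ α_q(u))(p)(v)`. -/
noncomputable def dF {n : ℕ} {V : Type*} [NormedAddCommGroup V] [NormedSpace ℝ V]
    (α : GalTot n → GalTot n → V) (p u v : GalTot n) : V :=
  fderiv ℝ (fun q => α q v) p u - fderiv ℝ (fun q => α q u) p v

/-- Wedge of a matrix-valued form with a vector-valued form:
`(β ∧ α)_p(u,v) = β_p(u)·α_p(v) − β_p(v)·α_p(u)`. -/
def mvWedge {n : ℕ} (β : GalTot n → GalTot n → Matrix (Fin n) (Fin n) ℝ)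
    (α : GalTot n → GalTot n → Fin n → ℝ) (p u v : GalTot n) : Fin n → ℝ :=
  (β p u).mulVec (α p v) - (β p v).mulVec (α p u)

/-- Wedge of a vector-valued form with a scalar-valued form:
`(α ∧ β)_p(u,v) = α_p(u)·β_p(v) − α_p(v)·β_p(u)`. -/
def vsWedge {n : ℕ} (α : GalTot n → GalTot n → Fin n → ℝ)
    (β : GalTot n → GalTot n → ℝ) (p u v : GalTot n) : Fin n → ℝ :=
  β p v • α p u - β p u • α p v

/-- Wedge of two matrix-valued forms:
`(β ∧ γ)_p(u,v) = β_p(u)·γ_p(v) − β_p(v)·γ_p(u)`. -/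
def mmWedge {n : ℕ} (β γ : GalTot n → GalTot n → Matrix (Fin n) (Fin n) ℝ)
    (p u v : GalTot n) : Matrix (Fin n) (Fin n) ℝ :=
  β p u * γ p v - β p v * γ p u

/-- The curvature 2-form `Φ = dφ + Π ∧ φ`. -/
noncomputable def curvPhi {n : ℕ} (Γ : JetPt n → Fin n → ℝ) (N : JetPt n → Matrix (Fin n) (Fin n) ℝ)
    (Γ3 : JetPt n → Fin n → Fin n → Fin n → ℝ) (p u v : GalTot n) : Fin n → ℝ :=
  dF (phiF Γ N) p u v + mvWedge (piF N Γ3) (phiF Γ N) p u v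

/-- The Jacobian matrix `∂Γ/∂y` of `Γ` with respect to the variables `y`. -/
noncomputable def jacY {n : ℕ} (Γ : JetPt n → Fin n → ℝ) (q : JetPt n) :
    Matrix (Fin n) (Fin n) ℝ :=
  Matrix.of fun i k => fderiv ℝ (fun y => Γ (q.1, q.2.1, y) i) q.2.2 (Pi.single k 1)

theorem jacY_apply {n : ℕ} {Γ : JetPt n → Fin n → ℝ} {q : JetPt n}
    (hΓ : DifferentiableAt ℝ Γ q) (i k : Fin n) :
    jacY Γ q i k = fderiv ℝ Γ q (0, 0, Pi.single k 1) i := by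
  have hc : HasFDerivAt (fun y => ((q.1, q.2.1, y) : JetPt n))
      ((0 : (Fin n → ℝ) →L[ℝ] ℝ).prod ((0 : (Fin n → ℝ) →L[ℝ] (Fin n → ℝ)).prod (.id ℝ _)))
      q.2.2 :=
    (hasFDerivAt_const _ _).prodMk ((hasFDerivAt_const _ _).prodMk (hasFDerivAt_id _))
  have h := hasFDerivAt_pi'.1
    (HasFDerivAt.comp (f := fun y => ((q.1, q.2.1, y) : JetPt n)) q.2.2 hΓ.hasFDerivAt hc) i
  exact congrArg (· (Pi.single k 1)) h.fderiv

theorem jacY_mulVec {n : ℕ} {Γ : JetPt n → Fin n → ℝ} {q : JetPt n}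
    (hΓ : DifferentiableAt ℝ Γ q) (w : Fin n → ℝ) :
    (jacY Γ q).mulVec w = fderiv ℝ Γ q (0, 0, w) := by
  let L : (Fin n → ℝ) →ₗ[ℝ] Fin n → ℝ := (fderiv ℝ Γ q).toLinearMap ∘ₗ
    LinearMap.inr ℝ ℝ _ ∘ₗ LinearMap.inr ℝ (Fin n → ℝ) (Fin n → ℝ)
  have hL : jacY Γ q = LinearMap.toMatrix' L := by
    ext i k
    rw [jacY_apply hΓ, LinearMap.toMatrix'_apply]
    rfl
  rw [hL, LinearMap.toMatrix'_mulVec]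
  rfl

open scoped ContDiff in
theorem contDiff_jacY {n : ℕ} {Γ : JetPt n → Fin n → ℝ} (hΓ : ContDiff ℝ ∞ Γ) :
    ContDiff ℝ ∞ (jacY Γ) := by
  refine contDiff_pi.2 fun i => contDiff_pi.2 fun k => ?_
  simp only [jacY_apply (hΓ.differentiable (by simp) _)]
  have h : ContDiff ℝ ∞ (fderiv ℝ Γ) := hΓ.fderiv_right (by simp)
  fun_prop

theorem differentiableAt_ringInverse_of_finiteDimensional {R : Type*} [NormedRing R]
    [NormedAlgebra ℝ R] [FiniteDimensional ℝ R] {a : R} (ha : IsUnit a) :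
    DifferentiableAt ℝ (Ring.inverse : R → R) a :=
  have : CompleteSpace R := FiniteDimensional.complete ℝ R
  differentiableAt_inverse ha

theorem differentiableAt_matrix_inv {ι : Type*} [Fintype ι] [DecidableEq ι] {A : Matrix ι ι ℝ}
    (hA : IsUnit A) : DifferentiableAt ℝ (fun B : Matrix ι ι ℝ => B⁻¹) A := by
  simp only [Matrix.nonsing_inv_eq_ringInverse]
  exact @differentiableAt_ringInverse_of_finiteDimensional _ Matrix.linftyOpNormedRing
    Matrix.linftyOpNormedAlgebra inferInstance A hA

/-- The derivative of `φ` in the base point, in direction `u`, on a constant vector `v` that is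
annihilated by `ω` at that point. -/
theorem mulVec_fderiv_phiF {n : ℕ} {Γ : JetPt n → Fin n → ℝ}
    {N : JetPt n → Matrix (Fin n) (Fin n) ℝ} (hΓ : Differentiable ℝ Γ) (hN : Differentiable ℝ N)
    {p : GalTot n} (hp : IsUnit p.2.2.2) (u : GalTot n) {v : GalTot n}
    (hv : v.2.1 = v.1 • p.2.2.1) :
    p.2.2.2.mulVec (fderiv ℝ (fun q => phiF Γ N q v) p u) =
      v.1 • fderiv ℝ Γ (baseOf p) (baseOf u) - v.1 • (N (baseOf p)).mulVec u.2.2.1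
        - u.2.2.2.mulVec (phiF Γ N p v) := by
  let B := (Matrix.mulVecBilin (m := Fin n) (n := Fin n) ℝ ℝ (A := ℝ)).toContinuousBilinearMap
  let b : GalTot n →L[ℝ] JetPt n := (ContinuousLinearMap.fst ℝ _ _).prod
    ((ContinuousLinearMap.fst ℝ _ _ ∘L ContinuousLinearMap.snd ℝ _ _).prod
      (ContinuousLinearMap.fst ℝ _ _ ∘L ContinuousLinearMap.snd ℝ _ _ ∘L
        ContinuousLinearMap.snd ℝ _ _))
  let a : GalTot n →L[ℝ] Matrix (Fin n) (Fin n) ℝ := ContinuousLinearMap.snd ℝ _ _ ∘L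
    ContinuousLinearMap.snd ℝ _ _ ∘L ContinuousLinearMap.snd ℝ _ _
  let y : GalTot n →L[ℝ] (Fin n → ℝ) := ContinuousLinearMap.fst ℝ _ _ ∘L
    ContinuousLinearMap.snd ℝ _ _ ∘L ContinuousLinearMap.snd ℝ _ _
  have hb : HasFDerivAt baseOf b p := b.hasFDerivAt
  have hNb := (hN (baseOf p)).hasFDerivAt.comp p hb
  have hΓb := (hΓ (baseOf p)).hasFDerivAt.comp p hb
  have hw : HasFDerivAt (fun q : GalTot n => v.2.1 - v.1 • q.2.2.1) (-(v.1 • y)) p :=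
    (y.hasFDerivAt.const_smul v.1).const_sub v.2.1
  let F : GalTot n → Fin n → ℝ := fun q =>
    v.2.2.1 + v.1 • Γ (baseOf q) + (N (baseOf q)).mulVec (v.2.1 - v.1 • q.2.2.1)
  have hF : HasFDerivAt F _ p :=
    ((hΓb.const_smul v.1).const_add v.2.2.1).add (B.hasFDerivAt_of_bilinear hNb hw)
  have hinv : DifferentiableAt ℝ (fun q : GalTot n => (q.2.2.2)⁻¹) p :=
    (differentiableAt_matrix_inv hp).comp (f := a) p a.differentiableAt
  have hφ : DifferentiableAt ℝ (fun q => phiF Γ N q v) p :=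
    (B.hasFDerivAt_of_bilinear hinv.hasFDerivAt hF).differentiableAt
  have hAφ := B.hasFDerivAt_of_bilinear a.hasFDerivAt hφ.hasFDerivAt
  have hdet : ∀ᶠ q : GalTot n in nhds p, IsUnit q.2.2.2.det := by
    have hc : Continuous fun q : GalTot n => q.2.2.2.det := by fun_prop
    filter_upwards [hc.continuousAt.eventually_ne
      ((Matrix.isUnit_iff_isUnit_det _).1 hp).ne_zero] with q hq using hq.isUnit
  have heq : (fun q => B (a q) (phiF Γ N q v)) =ᶠ[nhds p] F := by
    filter_upwards [hdet] with q hq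
    change q.2.2.2.mulVec ((q.2.2.2)⁻¹.mulVec _) = _
    rw [Matrix.mulVec_mulVec, Matrix.mul_nonsing_inv _ hq, Matrix.one_mulVec]
  have h := congrArg (· u) (hAφ.unique (hF.congr_of_eventuallyEq heq))
  change p.2.2.2.mulVec (fderiv ℝ (fun q => phiF Γ N q v) p u) + u.2.2.2.mulVec (phiF Γ N p v) =
    v.1 • fderiv ℝ Γ (baseOf p) (baseOf u) + ((N (baseOf p)).mulVec (-(v.1 • u.2.2.1)) +
      (fderiv ℝ N (baseOf p) (baseOf u)).mulVec (v.2.1 - v.1 • p.2.2.1)) at h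
  rw [hv, sub_self, Matrix.mulVec_zero, Matrix.mulVec_neg, Matrix.mulVec_smul] at h
  rw [eq_sub_of_add_eq h]
  abel

theorem eq_smul_of_omegaF_eq_zero {n : ℕ} {p : GalTot n} (hp : IsUnit p.2.2.2) {ξ : GalTot n}
    (h : omegaF p ξ = 0) : ξ.2.1 = ξ.1 • p.2.2.1 := by
  have hd := (Matrix.isUnit_iff_isUnit_det _).1 hp
  have h' := congrArg p.2.2.2.mulVec h
  rwa [omegaF, Matrix.mulVec_mulVec, Matrix.mul_nonsing_inv _ hd, Matrix.one_mulVec,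
    Matrix.mulVec_zero, sub_eq_zero] at h'

theorem eq_neg_smul_of_piF_eq_zero {n : ℕ} {N : JetPt n → Matrix (Fin n) (Fin n) ℝ}
    {Γ3 : JetPt n → Fin n → Fin n → Fin n → ℝ} {p : GalTot n} (hp : IsUnit p.2.2.2)
    {ξ : GalTot n} (hξ : ξ.2.1 = ξ.1 • p.2.2.1) (h : piF N Γ3 p ξ = 0) :
    ξ.2.2.2 = -(ξ.1 • (N (baseOf p) * p.2.2.2)) := by
  have hd := (Matrix.isUnit_iff_isUnit_det _).1 hp
  have hz : piF N Γ3 p ξ =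
      (p.2.2.2)⁻¹ * (ξ.2.2.2 + ξ.1 • (N (baseOf p) * p.2.2.2)) := by
    ext i j
    simp [piF, hξ, Matrix.mul_add, Matrix.mul_assoc]
  have h' := congrArg (p.2.2.2 * ·) (hz.symm.trans h)
  simp only [Matrix.mul_nonsing_inv_cancel_left _ _ hd, Matrix.mul_zero] at h'
  exact eq_neg_of_add_eq_zero_left h'

theorem mulVec_fderiv_phiF_of_piF_eq_zero {n : ℕ} {Γ : JetPt n → Fin n → ℝ}
    {N : JetPt n → Matrix (Fin n) (Fin n) ℝ} {Γ3 : JetPt n → Fin n → Fin n → Fin n → ℝ}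
    (hΓ : Differentiable ℝ Γ) (hN : Differentiable ℝ N)
    {p : GalTot n} (hp : IsUnit p.2.2.2) {u v : GalTot n}
    (hu : u.2.1 = u.1 • p.2.2.1) (hv : v.2.1 = v.1 • p.2.2.1) (hpi : piF N Γ3 p u = 0) :
    p.2.2.2.mulVec (fderiv ℝ (fun q => phiF Γ N q v) p u) =
      v.1 • fderiv ℝ Γ (baseOf p) (baseOf u) - v.1 • (N (baseOf p)).mulVec u.2.2.1
        + u.1 • (N (baseOf p)).mulVec (v.2.2.1 + v.1 • Γ (baseOf p)) := by
  have hd := (Matrix.isUnit_iff_isUnit_det _).1 hp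
  rw [mulVec_fderiv_phiF hΓ hN hp u hv, eq_neg_smul_of_piF_eq_zero hp hu hpi, phiF, hv, sub_self,
    Matrix.mulVec_zero, add_zero, Matrix.neg_mulVec, Matrix.smul_mulVec, Matrix.mulVec_mulVec,
    Matrix.mul_assoc, Matrix.mul_nonsing_inv _ hd, Matrix.mul_one, sub_neg_eq_add]

/-- The computational core of Chern's theorem: if `N = ½ ∂Γ/∂y` then the
curvature `Φ = dφ + Π ∧ φ` vanishes modulo `ω`, i.e. on pairs of tangent vectors
annihilated by `ω` and `Π`. -/
theorem chern_curvature_vanishes_mod_omega (n : ℕ) (hn : 1 ≤ n)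
    (Γ : JetPt n → Fin n → ℝ) (N : JetPt n → Matrix (Fin n) (Fin n) ℝ)
    (Γ3 : JetPt n → Fin n → Fin n → Fin n → ℝ)
    (hΓ : ContDiff ℝ (⊤ : ℕ∞) Γ) (hΓ3 : ContDiff ℝ (⊤ : ℕ∞) Γ3)
    (hsym : ∀ q l r s, Γ3 q l r s = Γ3 q l s r)
    (hNdef : N = fun q => (1 / 2 : ℝ) • jacY Γ q) :
    ∀ p : GalTot n, IsUnit p.2.2.2 → ∀ u v : GalTot n,
      omegaF p u = 0 → omegaF p v = 0 →
      piF N Γ3 p u = 0 → piF N Γ3 p v = 0 →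
      curvPhi Γ N Γ3 p u v = 0 := by
  intro p hp u v hωu hωv hpu hpv
  have hΓd : Differentiable ℝ Γ := hΓ.differentiable (by simp)
  have hNd : Differentiable ℝ N := by
    rw [hNdef]
    exact ((contDiff_jacY hΓ).differentiable (by simp)).const_smul (1 / 2 : ℝ)
  have hu := eq_smul_of_omegaF_eq_zero hp hωu
  have hv := eq_smul_of_omegaF_eq_zero hp hωv
  have hNmul (w : Fin n → ℝ) :
      fderiv ℝ Γ (baseOf p) (0, 0, w) = (2 : ℝ) • (N (baseOf p)).mulVec w := by
    rw [hNdef, Matrix.smul_mulVec, smul_smul, jacY_mulVec (hΓd _)]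
    norm_num
  have hvert : v.1 • baseOf u - u.1 • baseOf v =
      (0, 0, v.1 • u.2.2.1 - u.1 • v.2.2.1) := by
    simp only [baseOf, hu, hv, Prod.smul_mk, Prod.mk_sub_mk, smul_eq_mul, smul_smul]
    rw [mul_comm v.1 u.1, sub_self, sub_self]
  have hD := congrArg (fderiv ℝ Γ (baseOf p)) hvert
  rw [hNmul, map_sub, map_smul, map_smul, Matrix.mulVec_sub, Matrix.mulVec_smul,
    Matrix.mulVec_smul] at hD
  apply Matrix.mulVec_injective_of_isUnit hp
  rw [Matrix.mulVec_zero, curvPhi, mvWedge, hpu, hpv, Matrix.zero_mulVec, Matrix.zero_mulVec,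
    sub_zero, add_zero, dF, Matrix.mulVec_sub,
    mulVec_fderiv_phiF_of_piF_eq_zero hΓd hNd hp hu hv hpu,
    mulVec_fderiv_phiF_of_piF_eq_zero hΓd hNd hp hv hu hpv]
  simp only [Matrix.mulVec_add, Matrix.mulVec_smul]
  linear_combination (norm := module) hD
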